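/- arXiv:1610.09142 — 6 statements merged into one kernel-verified Lean document; each statement's English description precedes it below -/
import Mathlib

section
/- Let m be a positive even integer, Λ = ℤ/(2m+2)ℤ, and let (a_x)_{x∈Λ} be a CAR family on a complex Hilbert space. Then the finite-volume Nicolai supercharge Q = Σ_{x∈Λ, x even} a_{x+1} a_x* a_{x−1} is nilpotent: Q² = 0 and (Q*)² = 0. -/
open ContinuousLinearMap

instance (m : ℕ) : NeZero (2 * m + 2) := ⟨by omega⟩

/-- The finite-volume Nicolai supercharge `Q = Σ_{x even} a_{x+1} a_x* a_{x-1}` on the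
periodic chain `Λ = ℤ/(2m+2)ℤ`; "x even" means the (well-defined) parity of the residue. -/
noncomputable def nicolaiCharge {E : Type*} [NormedAddCommGroup E] [InnerProductSpace ℂ E]
    [CompleteSpace E] (m : ℕ) (a : ZMod (2 * m + 2) → E →L[ℂ] E) : E →L[ℂ] E :=
  ∑ x ∈ Finset.univ.filter (fun x : ZMod (2 * m + 2) => Even x.val),
    a (x + 1) * adjoint (a x) * a (x - 1)

/-- If `x` anticommutes with `u`, `v`, `w`, then it anticommutes with `u * v * w`. -/
theorem anti_triple {R : Type*} [Ring R] {x u v w : R} (hu : x * u = -(u * x))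
    (hv : x * v = -(v * x)) (hw : x * w = -(w * x)) :
    x * (u * v * w) = -(u * v * w * x) := by
  calc x * (u * v * w) = (x * u) * v * w := by noncomm_ring
    _ = -(u * (x * v) * w) := by rw [hu]; noncomm_ring
    _ = u * v * (x * w) := by rw [hv]; noncomm_ring
    _ = -(u * v * w * x) := by rw [hw]; noncomm_ring

/-- If `p`, `q`, `r` anticommute with `t`, so does `p * q * r`. -/
theorem triple_anti {R : Type*} [Ring R] {p q r t : R} (hp : p * t = -(t * p))
    (hq : q * t = -(t * q)) (hr : r * t = -(t * r)) :
    p * q * r * t = -(t * (p * q * r)) := by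
  calc p * q * r * t = p * q * (r * t) := by noncomm_ring
    _ = -(p * (q * t) * r) := by rw [hr]; noncomm_ring
    _ = (p * t) * q * r := by rw [hq]; noncomm_ring
    _ = -(t * (p * q * r)) := by rw [hp]; noncomm_ring

/-- The neighbours of an even residue are not even. -/
theorem even_ne_neighbour (m : ℕ) {x y : ZMod (2 * m + 2)} (hx : Even x.val)
    (hy : Even y.val) : x ≠ y + 1 ∧ x ≠ y - 1 := by
  have hd : 2 ∣ 2 * m + 2 := ⟨m + 1, by ring⟩
  have key : ∀ z : ZMod (2 * m + 2), Even z.val → ZMod.castHom hd (ZMod 2) z = 0 := by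
    intro z hz
    rw [← ZMod.natCast_zmod_val z, map_natCast]
    exact (ZMod.natCast_eq_zero_iff_even).2 hz
  constructor
  · intro h
    have := congrArg (ZMod.castHom hd (ZMod 2)) h
    rw [map_add, map_one, key x hx, key y hy] at this
    exact absurd this (by decide)
  · intro h
    have := congrArg (ZMod.castHom hd (ZMod 2)) h
    rw [map_sub, map_one, key x hx, key y hy] at this
    exact absurd this (by decide)

/-- For a CAR family on `Λ = ℤ/(2m+2)ℤ` (`m` positive and even), the
finite-volume Nicolai supercharge is nilpotent: `Q² = 0` and `(Q*)² = 0`. -/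
theorem nicolai_supercharge_nilpotent
    {E : Type*} [NormedAddCommGroup E] [InnerProductSpace ℂ E] [CompleteSpace E]
    (m : ℕ) (hm : 0 < m) (hme : Even m) (a : ZMod (2 * m + 2) → E →L[ℂ] E)
    (hcar1 : ∀ x y, a x * a y + a y * a x = 0)
    (hcar2 : ∀ x y, adjoint (a x) * a y + a y * adjoint (a x)
        = if x = y then (1 : E →L[ℂ] E) else 0) :
    nicolaiCharge m a ^ 2 = 0 ∧ adjoint (nicolaiCharge m a) ^ 2 = 0 := by
  have h1 : ∀ x y, a x * a y = -(a y * a x) := fun x y => eq_neg_of_add_eq_zero_left (hcar1 x y)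
  have h2 : ∀ x y, adjoint (a x) * adjoint (a y) = -(adjoint (a y) * adjoint (a x)) := by
    intro x y
    have h := congrArg star (h1 y x)
    rw [star_neg, star_mul, star_mul] at h
    exact h
  have h3 : ∀ x y, x ≠ y → adjoint (a x) * a y = -(a y * adjoint (a x)) := by
    intro x y hxy
    have h := hcar2 x y
    rw [if_neg hxy] at h
    exact eq_neg_of_add_eq_zero_left h
  have h4 : ∀ x y, x ≠ y → a y * adjoint (a x) = -(adjoint (a x) * a y) := by
    intro x y hxy
    rw [h3 x y hxy, neg_neg]
  have hQ : nicolaiCharge m a * nicolaiCharge m a = -(nicolaiCharge m a * nicolaiCharge m a) := by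
    unfold nicolaiCharge
    rw [Finset.sum_mul_sum]
    conv_rhs => rw [Finset.sum_comm]
    rw [← Finset.sum_neg_distrib]
    refine Finset.sum_congr rfl fun x hx => ?_
    rw [← Finset.sum_neg_distrib]
    refine Finset.sum_congr rfl fun y hy => ?_
    have hx' := (Finset.mem_filter.1 hx).2
    have hy' := (Finset.mem_filter.1 hy).2
    obtain ⟨hxy1, hxy2⟩ := even_ne_neighbour m hx' hy'
    obtain ⟨hyx1, hyx2⟩ := even_ne_neighbour m hy' hx'
    exact triple_anti
      (anti_triple (h1 _ _) (h4 _ _ hyx1) (h1 _ _))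
      (anti_triple (h3 _ _ hxy1) (h2 _ _) (h3 _ _ hxy2))
      (anti_triple (h1 _ _) (h4 _ _ hyx2) (h1 _ _))
  have hQ0 : nicolaiCharge m a ^ 2 = 0 := by
    rw [pow_two]
    have h : (2 : ℂ) • (nicolaiCharge m a * nicolaiCharge m a) = 0 := by
      rw [two_smul]
      exact eq_neg_iff_add_eq_zero.1 hQ
    exact (smul_eq_zero.1 h).resolve_left two_ne_zero
  refine ⟨hQ0, ?_⟩
  have h := congrArg star hQ0
  rw [star_pow, star_zero] at h
  exact h
end

section
/- Let m be a positive even integer, Λ = ℤ/(2m+2)ℤ, and let (a_x)_{x∈Λ} be a CAR family on a complex Hilbert space. Let Q = Σ_{x∈Λ, x even} a_{x+1} a_x* a_{x−1} be the finite-volume Nicolai supercharge and set n_x = a_x* a_x. Then the supersymmetric Hamiltonian decomposes into a classical part and a hopping part: QQ* + Q*Q = Σ_{x even} (n_x − n_{x−1} n_x − n_x n_{x+1} + n_{x−1} n_{x+1}) + Σ_{x even} (a_x* a_{x−1} a_{x+2} a_{x+3}* + a_{x−1}* a_x a_{x+3} a_{x+2}*), both sums running over the even residues of Λ. -/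
open ContinuousLinearMap

/-- The fermion number operator `n_x = a_x* a_x`. -/
noncomputable def numOp {E : Type*} [NormedAddCommGroup E] [InnerProductSpace ℂ E]
    [CompleteSpace E] (m : ℕ) (a : ZMod (2 * m + 2) → E →L[ℂ] E)
    (x : ZMod (2 * m + 2)) : E →L[ℂ] E :=
  adjoint (a x) * a x

section NicolaiAux

/-- anticommutation with a triple product -/
lemma nic_anti3 {R : Type*} [Ring R] {p x y z : R} (h1 : p * x = -(x * p)) (h2 : p * y = -(y * p))
    (h3 : p * z = -(z * p)) : p * (x * y * z) = -(x * y * z * p) := by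
  calc p * (x * y * z) = (p * x) * y * z := by noncomm_ring
    _ = -(x * (p * y) * z) := by rw [h1]; noncomm_ring
    _ = (x * y * (p * z)) := by rw [h2]; noncomm_ring
    _ = -(x * y * z * p) := by rw [h3]; noncomm_ring

lemma nic_anti3' {R : Type*} [Ring R] {p x y z : R} (h1 : x * p = -(p * x)) (h2 : y * p = -(p * y))
    (h3 : z * p = -(p * z)) : (x * y * z) * p = -(p * (x * y * z)) := by
  have := nic_anti3 (p := p) (x := x) (y := y) (z := z) (by rw [h1, neg_neg]) (by rw [h2, neg_neg])
    (by rw [h3, neg_neg])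
  rw [this, neg_neg]

lemma nic_comm2 {R : Type*} [Ring R] {p x y : R} (h1 : p * x = -(x * p)) (h2 : p * y = -(y * p)) :
    Commute (x * y) p := by
  change x * y * p = p * (x * y)
  symm
  calc p * (x * y) = (p * x) * y := by noncomm_ring
    _ = -(x * (p * y)) := by rw [h1]; noncomm_ring
    _ = x * y * p := by rw [h2]; noncomm_ring

variable {R : Type*} [Ring R] [StarRing R] {ι : Type*}

/-- Local charge term. -/
def nicQ (a : ι → R) (p o l : ι) : R := a p * star (a o) * a l

lemma nic_far (a : ι → R)
    (h1 : ∀ x y, a x * a y = -(a y * a x))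
    (h2 : ∀ x y, x ≠ y → star (a x) * a y = -(a y * star (a x)))
    (p o l p' o' l' : ι)
    (e1 : p ≠ p') (e3 : p ≠ l')
    (e5 : o ≠ o')
    (e7 : l ≠ p') (e9 : l ≠ l') :
    nicQ a p o l * star (nicQ a p' o' l') + star (nicQ a p' o' l') * nicQ a p o l = 0 := by
  have h1s : ∀ x y, star (a x) * star (a y) = -(star (a y) * star (a x)) := by
    intro x y
    have := congrArg star (h1 y x)
    simpa using this
  have h2' : ∀ x y, x ≠ y → a x * star (a y) = -(star (a y) * a x) := by
    intro x y h
    rw [h2 y x h.symm, neg_neg]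
  simp only [nicQ, star_mul, star_star, ← mul_assoc]
  have : (a p * star (a o) * a l) * (star (a l') * a o' * star (a p'))
      = -((star (a l') * a o' * star (a p')) * (a p * star (a o) * a l)) := by
    apply nic_anti3' <;> apply nic_anti3
    all_goals first
      | exact h1 _ _
      | exact h1s _ _
      | (apply h2'; assumption)
      | (apply h2; assumption)
  rw [← mul_assoc, ← mul_assoc, ← mul_assoc, ← mul_assoc] at this
  rw [this, neg_add_cancel]

lemma nic_near (a : ι → R)
    (h1 : ∀ x y, a x * a y = -(a y * a x))
    (h2 : ∀ x y, x ≠ y → star (a x) * a y = -(a y * star (a x)))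
    (h3 : ∀ x, star (a x) * a x + a x * star (a x) = 1)
    (l o p u v : ι)
    (e1 : l ≠ p) (e2 : o ≠ p) (e3 : u ≠ p) (e4 : v ≠ p) (e5 : l ≠ v) (e6 : o ≠ u) :
    nicQ a p o l * star (nicQ a v u p) + star (nicQ a v u p) * nicQ a p o l
      = star (a o) * a l * a u * star (a v) := by
  have h1s : ∀ x y, star (a x) * star (a y) = -(star (a y) * star (a x)) := by
    intro x y
    have := congrArg star (h1 y x)
    simpa using this
  have h2' : ∀ x y, x ≠ y → a x * star (a y) = -(star (a y) * a x) := by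
    intro x y h
    rw [h2 y x h.symm, neg_neg]
  have c1 : star (a o) * a l * star (a p) = star (a p) * (star (a o) * a l) :=
    nic_comm2 (h1s _ _) (h2 _ _ e1.symm)
  have c2 : a u * star (a v) * a p = a p * (a u * star (a v)) :=
    nic_comm2 (h1 _ _) (h2' _ _ e4.symm)
  have c3 : a u * star (a v) * (star (a o) * a l) = (star (a o) * a l) * (a u * star (a v)) := by
    apply Commute.mul_right <;> apply nic_comm2
    · exact h2 _ _ e6
    · exact h1s _ _
    · exact h1 _ _
    · exact h2' _ _ e5
  simp only [nicQ, star_mul, star_star]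
  calc _ = a p * (star (a o) * a l * star (a p)) * (a u * star (a v))
        + star (a p) * (a u * star (a v) * a p) * (star (a o) * a l) := by noncomm_ring
    _ = a p * star (a p) * ((star (a o) * a l) * (a u * star (a v)))
        + star (a p) * a p * (a u * star (a v) * (star (a o) * a l)) := by
          rw [c1, c2]; noncomm_ring
    _ = (star (a p) * a p + a p * star (a p)) * ((star (a o) * a l) * (a u * star (a v))) := by
          rw [c3]; noncomm_ring
    _ = _ := by rw [h3]; noncomm_ring

lemma nic_near' (a : ι → R)
    (h1 : ∀ x y, a x * a y = -(a y * a x))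
    (h2 : ∀ x y, x ≠ y → star (a x) * a y = -(a y * star (a x)))
    (h3 : ∀ x, star (a x) * a x + a x * star (a x) = 1)
    (l o p u v : ι)
    (e1 : l ≠ p) (e2 : o ≠ p) (e3 : u ≠ p) (e4 : v ≠ p) (e5 : l ≠ v) (e6 : o ≠ u)
    (e7 : l ≠ u) (e8 : o ≠ v) :
    nicQ a v u p * star (nicQ a p o l) + star (nicQ a p o l) * nicQ a v u p
      = star (a l) * a o * a v * star (a u) := by
  have h1s : ∀ x y, star (a x) * star (a y) = -(star (a y) * star (a x)) := by
    intro x y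
    have := congrArg star (h1 y x)
    simpa using this
  have h2' : ∀ x y, x ≠ y → a x * star (a y) = -(star (a y) * a x) := by
    intro x y h
    rw [h2 y x h.symm, neg_neg]
  have c3 : a v * star (a u) * (star (a l) * a o) = (star (a l) * a o) * (a v * star (a u)) := by
    apply Commute.mul_right <;> apply nic_comm2
    · exact h2 _ _ e5
    · exact h1s _ _
    · exact h1 _ _
    · exact h2' _ _ e6
  have := congrArg star (nic_near a h1 h2 h3 l o p u v e1 e2 e3 e4 e5 e6)
  simp only [star_add, star_mul, star_star] at this
  rw [this]
  calc _ = a v * star (a u) * (star (a l) * a o) := by noncomm_ring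
    _ = _ := by rw [c3]; noncomm_ring

lemma nic_diag (a : ι → R)
    (h1 : ∀ x y, a x * a y = -(a y * a x))
    (h2 : ∀ x y, x ≠ y → star (a x) * a y = -(a y * star (a x)))
    (h3 : ∀ x, star (a x) * a x + a x * star (a x) = 1)
    (l o p : ι) (e1 : l ≠ o) (e2 : o ≠ p) (e3 : l ≠ p) :
    nicQ a p o l * star (nicQ a p o l) + star (nicQ a p o l) * nicQ a p o l
      = star (a o) * a o - (star (a l) * a l) * (star (a o) * a o)
        - (star (a o) * a o) * (star (a p) * a p) + (star (a l) * a l) * (star (a p) * a p) := by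
  have h1s : ∀ x y, star (a x) * star (a y) = -(star (a y) * star (a x)) := by
    intro x y
    have := congrArg star (h1 y x)
    simpa using this
  have h2' : ∀ x y, x ≠ y → a x * star (a y) = -(star (a y) * a x) := by
    intro x y h
    rw [h2 y x h.symm, neg_neg]
  have k : ∀ x y, x ≠ y → Commute (star (a x) * a x) (a y) := fun x y h =>
    nic_comm2 (h2' _ _ h.symm) (h1 _ _)
  have ks : ∀ x y, x ≠ y → Commute (star (a x) * a x) (star (a y)) := fun x y h =>
    nic_comm2 (h1s _ _) (h2 _ _ h.symm)
  have kn : ∀ x y, x ≠ y → Commute (star (a x) * a x) (star (a y) * a y) := fun x y h =>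
    (ks x y h).mul_right (k x y h)
  have h3' : ∀ x, a x * star (a x) = 1 - star (a x) * a x := fun x =>
    eq_sub_of_add_eq' (h3 x)
  simp only [nicQ, star_mul, star_star]
  have A : a p * star (a o) * a l * (star (a l) * (a o * star (a p)))
      = (1 - star (a l) * a l) * (star (a o) * a o) * (1 - star (a p) * a p) := by
    have q1 : Commute (1 - star (a l) * a l) (star (a o)) :=
      (Commute.one_left _).sub_left (ks l o e1)
    have q2 : Commute (1 - star (a l) * a l) (a p) :=
      (Commute.one_left _).sub_left (k l p e3)
    have q3 : Commute (star (a o) * a o) (a p) := k o p e2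
    calc _ = a p * (star (a o) * (a l * star (a l))) * a o * star (a p) := by noncomm_ring
      _ = a p * (1 - star (a l) * a l) * (star (a o) * a o) * star (a p) := by
        rw [h3', ← q1.eq]; simp only [mul_assoc]
      _ = (1 - star (a l) * a l) * (a p * (star (a o) * a o)) * star (a p) := by
        rw [← q2.eq]; simp only [mul_assoc]
      _ = (1 - star (a l) * a l) * (star (a o) * a o) * (a p * star (a p)) := by
        rw [← q3.eq]; simp only [mul_assoc]
      _ = _ := by rw [h3']
  have B : star (a l) * (a o * star (a p)) * (a p * star (a o) * a l)
      = (star (a l) * a l) * (1 - star (a o) * a o) * (star (a p) * a p) := by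
    have q1 : Commute (star (a p) * a p) (star (a o)) := ks p o e2.symm
    have q2 : Commute (star (a p) * a p) (a l) := k p l e3.symm
    have q3 : Commute (1 - star (a o) * a o) (a l) :=
      (Commute.one_left _).sub_left (k o l e1.symm)
    calc _ = star (a l) * a o * ((star (a p) * a p) * star (a o)) * a l := by noncomm_ring
      _ = star (a l) * (a o * star (a o)) * ((star (a p) * a p) * a l) := by
        rw [q1.eq]; simp only [mul_assoc]
      _ = star (a l) * ((1 - star (a o) * a o) * a l) * (star (a p) * a p) := by
        rw [h3', q2.eq]; simp only [mul_assoc]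
      _ = _ := by rw [q3.eq]; simp only [mul_assoc]
  rw [A, B]
  noncomm_ring

end NicolaiAux

lemma nic_ne {K : Type*} [CommRing K] {x y c : K} (hc : c ≠ 0) (h : x - y = c ∨ y - x = c) :
    x ≠ y := by
  rintro rfl
  rw [sub_self, or_self] at h
  exact hc h.symm

lemma nic_even_iff (m : ℕ) (x : ZMod (2 * m + 2)) :
    Even x.val ↔ ZMod.castHom (show 2 ∣ 2 * m + 2 by omega) (ZMod 2) x = 0 := by
  rw [even_iff_two_dvd, ← ZMod.natCast_eq_zero_iff, ZMod.castHom_apply, ZMod.natCast_val]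

/-- For a CAR family on `Λ = ℤ/(2m+2)ℤ` (`m` positive and even), the
supersymmetric Nicolai Hamiltonian `QQ* + Q*Q` decomposes into its classical part and its
hopping part. -/
theorem nicolai_hamiltonian_decomposition
    {E : Type*} [NormedAddCommGroup E] [InnerProductSpace ℂ E] [CompleteSpace E]
    (m : ℕ) (hm : 0 < m) (hme : Even m) (a : ZMod (2 * m + 2) → E →L[ℂ] E)
    (hcar1 : ∀ x y, a x * a y + a y * a x = 0)
    (hcar2 : ∀ x y, adjoint (a x) * a y + a y * adjoint (a x)
        = if x = y then (1 : E →L[ℂ] E) else 0) :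
    nicolaiCharge m a * adjoint (nicolaiCharge m a)
        + adjoint (nicolaiCharge m a) * nicolaiCharge m a
      = (∑ x ∈ Finset.univ.filter (fun x : ZMod (2 * m + 2) => Even x.val),
          (numOp m a x - numOp m a (x - 1) * numOp m a x
            - numOp m a x * numOp m a (x + 1)
            + numOp m a (x - 1) * numOp m a (x + 1)))
        + ∑ x ∈ Finset.univ.filter (fun x : ZMod (2 * m + 2) => Even x.val),
          (adjoint (a x) * a (x - 1) * a (x + 2) * adjoint (a (x + 3))
            + adjoint (a (x - 1)) * a x * a (x + 3) * adjoint (a (x + 2))) := by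
  have hm2 : 2 ≤ m := by obtain ⟨k, hk⟩ := hme; omega
  have h1 : ∀ x y, a x * a y = -(a y * a x) := fun x y => eq_neg_of_add_eq_zero_left (hcar1 x y)
  have h2 : ∀ x y, x ≠ y → star (a x) * a y = -(a y * star (a x)) := fun x y h => by
    have := hcar2 x y
    rw [if_neg h] at this
    exact eq_neg_of_add_eq_zero_left this
  have h3 : ∀ x, star (a x) * a x + a x * star (a x) = 1 := fun x => by
    have := hcar2 x x
    rw [if_pos rfl] at this
    exact this
  have hk : ∀ k : ℕ, 0 < k → k < 6 → (k : ZMod (2 * m + 2)) ≠ 0 := by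
    intro k h0 h6 h
    rw [ZMod.natCast_eq_zero_iff] at h
    have := Nat.le_of_dvd h0 h
    omega
  have k1 : (1 : ZMod (2 * m + 2)) ≠ 0 := by exact_mod_cast hk 1 (by norm_num) (by norm_num)
  have k2 : (2 : ZMod (2 * m + 2)) ≠ 0 := by exact_mod_cast hk 2 (by norm_num) (by norm_num)
  have k3 : (3 : ZMod (2 * m + 2)) ≠ 0 := by exact_mod_cast hk 3 (by norm_num) (by norm_num)
  have k4 : (4 : ZMod (2 * m + 2)) ≠ 0 := by exact_mod_cast hk 4 (by norm_num) (by norm_num)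
  simp only [← star_eq_adjoint, numOp]
  set S := Finset.univ.filter (fun x : ZMod (2 * m + 2) => Even x.val) with hS
  have hmem : ∀ x, x ∈ S ↔ Even x.val := fun x => by simp [hS]
  have hS2 : ∀ x ∈ S, x + 2 ∈ S := by
    intro x hx
    rw [hmem, nic_even_iff] at hx ⊢
    rw [map_add, hx, map_ofNat]
    decide
  set q : ZMod (2 * m + 2) → (E →L[ℂ] E) := fun x => nicQ a (x + 1) x (x - 1) with hq
  have hQ : nicolaiCharge m a = ∑ x ∈ S, q x := rfl
  have key : ∀ x ∈ S, ∀ y ∈ S, q x * star (q y) + star (q y) * q x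
      = (if y = x then star (a x) * a x - (star (a (x-1)) * a (x-1)) * (star (a x) * a x)
        - (star (a x) * a x) * (star (a (x+1)) * a (x+1))
        + (star (a (x-1)) * a (x-1)) * (star (a (x+1)) * a (x+1)) else 0)
        + (if y = x + 2 then star (a x) * a (x - 1) * a (x + 2) * star (a (x + 3)) else 0)
        + (if x = y + 2 then star (a (y - 1)) * a y * a (y + 3) * star (a (y + 2)) else 0) := by
    intro x hx y hy
    by_cases c1 : y = x
    · subst c1
      rw [if_pos rfl, if_neg (nic_ne k2 (by right; ring)), if_neg (nic_ne k2 (by right; ring)), add_zero, add_zero]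
      exact nic_diag a h1 h2 h3 _ _ _ (nic_ne k1 (by right; ring)) (nic_ne k1 (by right; ring))
        (nic_ne k2 (by right; ring))
    by_cases c2 : y = x + 2
    · subst c2
      rw [if_neg c1, if_pos rfl, if_neg (nic_ne k4 (by right; ring)), zero_add, add_zero]
      have := nic_near a h1 h2 h3 (x - 1) x (x + 1) (x + 2) (x + 3)
        (nic_ne k2 (by right; ring)) (nic_ne k1 (by right; ring)) (nic_ne k1 (by left; ring))
        (nic_ne k2 (by left; ring)) (nic_ne k4 (by right; ring)) (nic_ne k2 (by right; ring))
      simp only [hq]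
      rw [show x + 2 + 1 = x + 3 by ring, show x + 2 - 1 = x + 1 by ring]
      exact this
    by_cases c3 : x = y + 2
    · subst c3
      rw [if_neg c1, if_neg c2, if_pos rfl, zero_add, zero_add]
      have := nic_near' a h1 h2 h3 (y - 1) y (y + 1) (y + 2) (y + 3)
        (nic_ne k2 (by right; ring)) (nic_ne k1 (by right; ring)) (nic_ne k1 (by left; ring))
        (nic_ne k2 (by left; ring)) (nic_ne k4 (by right; ring)) (nic_ne k2 (by right; ring))
        (nic_ne k3 (by right; ring)) (nic_ne k3 (by right; ring))
      simp only [hq]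
      rw [show y + 2 + 1 = y + 3 by ring, show y + 2 - 1 = y + 1 by ring]
      exact this
    rw [if_neg c1, if_neg c2, if_neg c3, add_zero, add_zero]
    exact nic_far a h1 h2 _ _ _ _ _ _ (fun h => c1 (by linear_combination -h))
      (fun h => c2 (by linear_combination -h)) (fun h => c1 (by linear_combination -h))
      (fun h => c3 (by linear_combination h)) (fun h => c1 (by linear_combination -h))
  rw [hQ, star_sum, Finset.sum_mul_sum, Finset.sum_mul_sum,
    Finset.sum_comm (f := fun i j => star (q i) * q j), ← Finset.sum_add_distrib]
  simp only [← Finset.sum_add_distrib]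
  rw [Finset.sum_congr rfl (fun x hx => Finset.sum_congr rfl (fun y hy => key x hx y hy))]
  simp only [Finset.sum_add_distrib]
  rw [add_assoc]
  congr 1
  · simp [Finset.sum_ite_eq', Finset.sum_add_distrib]
  congr 1
  · refine Finset.sum_congr rfl fun x hx => ?_
    rw [Finset.sum_ite_eq', if_pos (hS2 x hx)]
  · rw [Finset.sum_comm]
    refine Finset.sum_congr rfl fun x hx => ?_
    rw [Finset.sum_ite_eq', if_pos (hS2 x hx)]
end

section
/- Let k < l and p < q be integers, f ∈ Ξ̂_{k,l} and g ∈ Ξ̂_{p,q}. If the intervals {2k,…,2l} and {2p,…,2q} are disjoint, or if there exists a site x lying in both intervals with f(x) = g(x), then the associated local fermion operators anticommute: 𝒬(f)𝒬(g) + 𝒬(g)𝒬(f) = 0. -/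
open ContinuousLinearMap

/-- `ζ_i(-1) = a_i`, `ζ_i(+1) = a_i*`. -/
noncomputable def zeta {E : Type*} [NormedAddCommGroup E] [InnerProductSpace ℂ E]
    [CompleteSpace E] (a : ℤ → E →L[ℂ] E) (i : ℤ) (v : ℤ) : E →L[ℂ] E :=
  if v = 1 then adjoint (a i) else a i

/-- The set `Ξ̂_{k,l}`: `f : {2k,…,2l} → {±1}` is permitted (contains no forbidden triplet
`(-1,+1,-1)` or `(+1,-1,+1)` centered at an even site) and takes a constant value on each
of the edge pairs `{2k, 2k+1}` and `{2l-1, 2l}`. -/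
def IsHatXi (k l : ℤ) (f : ℤ → ℤ) : Prop :=
  (∀ i ∈ Finset.Icc (2 * k) (2 * l), f i = 1 ∨ f i = -1) ∧
  (¬ ∃ i : ℤ, 2 * k ≤ 2 * i - 1 ∧ 2 * i + 1 ≤ 2 * l ∧
      ((f (2 * i - 1) = -1 ∧ f (2 * i) = 1 ∧ f (2 * i + 1) = -1) ∨
       (f (2 * i - 1) = 1 ∧ f (2 * i) = -1 ∧ f (2 * i + 1) = 1))) ∧
  f (2 * k) = f (2 * k + 1) ∧ f (2 * l - 1) = f (2 * l)

/-- The local fermion monomial `𝒬(f) = ζ_{2k}(f(2k)) ζ_{2k+1}(f(2k+1)) ⋯ ζ_{2l}(f(2l))`,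
the product taken in increasing order of the sites. -/
noncomputable def fermionMonomial {E : Type*} [NormedAddCommGroup E] [InnerProductSpace ℂ E]
    [CompleteSpace E] (a : ℤ → E →L[ℂ] E) (k l : ℤ) (f : ℤ → ℤ) : E →L[ℂ] E :=
  ((List.range ((2 * (l - k)).toNat + 1)).map
    (fun j => zeta a (2 * k + (j : ℤ)) (f (2 * k + (j : ℤ))))).prod

theorem mem_coe_range (n : ℕ) (i : ℤ) :
    i ∈ (do let a ← List.range n; pure (a : ℤ) : List ℤ) ↔ 0 ≤ i ∧ i < n := by
  simp only [List.bind_eq_flatMap, List.pure_def, List.mem_flatMap, List.mem_range,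
    List.mem_singleton]
  constructor
  · rintro ⟨j, hj, rfl⟩; omega
  · intro h; exact ⟨i.toNat, by omega, by omega⟩

theorem length_coe_range (n : ℕ) :
    (do let a ← List.range n; pure (a : ℤ) : List ℤ).length = n := by
  simp

theorem anti_list_prod {R : Type*} [Ring R] (z : R) (L : List R)
    (h : ∀ y ∈ L, z * y = -(y * z)) : z * L.prod = (-1) ^ L.length * (L.prod * z) := by
  induction L with
  | nil => simp
  | cons y L ih =>
    have h1 := ih (fun y hy => h y (List.mem_cons_of_mem _ hy))
    have h2 := h y List.mem_cons_self
    have hc : y * (-1) ^ L.length = (-1) ^ L.length * y :=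
      ((Commute.neg_one_right y).pow_right _).eq
    rw [List.prod_cons, ← mul_assoc, h2, neg_mul, mul_assoc, h1, ← mul_assoc, hc,
      List.length_cons, pow_succ]
    simp [mul_assoc]

theorem anti_list_prod_prod {R : Type*} [Ring R] (L M : List R) (hM : Odd M.length)
    (h : ∀ y ∈ L, ∀ w ∈ M, y * w = -(w * y)) :
    L.prod * M.prod = (-1) ^ L.length * (M.prod * L.prod) := by
  induction L with
  | nil => simp
  | cons y L ih =>
    have h1 := ih (fun y hy => h y (List.mem_cons_of_mem _ hy))
    have h2 := anti_list_prod y M (h y List.mem_cons_self)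
    rw [hM.neg_one_pow] at h2
    have hc : y * (-1) ^ L.length = (-1) ^ L.length * y :=
      ((Commute.neg_one_right y).pow_right _).eq
    rw [List.prod_cons, mul_assoc, h1, ← mul_assoc, hc, mul_assoc, ← mul_assoc y, h2,
      List.length_cons, pow_succ]
    simp [mul_assoc]

theorem nil_list_prod {R : Type*} [Ring R] (z : R) (hz : z * z = 0) (L : List R)
    (h : ∀ y ∈ L, y = z ∨ z * y = -(y * z)) (hm : z ∈ L) : z * L.prod = 0 := by
  induction L with
  | nil => simp at hm
  | cons y L ih =>
    rw [List.prod_cons, ← mul_assoc]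
    by_cases hy : y = z
    · rw [hy, hz, zero_mul]
    · have h2 := (h y List.mem_cons_self).resolve_left hy
      have h3 : z ∈ L := (List.mem_cons.1 hm).resolve_left (fun e => hy e.symm)
      rw [h2, neg_mul, mul_assoc, ih (fun y hy => h y (List.mem_cons_of_mem _ hy)) h3]
      simp

theorem nil_list_prod_left {R : Type*} [Ring R] (z X : R) (hz : z * z = 0) (hX : z * X = 0)
    (L : List R) (h : ∀ y ∈ L, y = z ∨ z * y = -(y * z)) : z * (L.prod * X) = 0 := by
  induction L with
  | nil => simpa using hX
  | cons y L ih =>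
    rw [List.prod_cons, mul_assoc, ← mul_assoc]
    rcases h y List.mem_cons_self with hy | hy
    · rw [hy, hz, zero_mul]
    · rw [hy, neg_mul, mul_assoc, ih (fun y hy => h y (List.mem_cons_of_mem _ hy))]
      simp

theorem nil_list_prod_mul {R : Type*} [Ring R] (z X : R) (hz : z * z = 0) (hX : z * X = 0)
    (L : List R) (h : ∀ y ∈ L, y = z ∨ z * y = -(y * z)) (hm : z ∈ L) : L.prod * X = 0 := by
  induction L with
  | nil => simp at hm
  | cons y L ih =>
    have h' : ∀ y ∈ L, y = z ∨ z * y = -(y * z) := fun y hy => h y (List.mem_cons_of_mem _ hy)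
    rw [List.prod_cons, mul_assoc]
    rcases List.mem_cons.1 hm with hy | hy
    · rw [← hy]; exact nil_list_prod_left z X hz hX L h'
    · rw [ih h' hy, mul_zero]

section
variable {E : Type*} [NormedAddCommGroup E] [InnerProductSpace ℂ E] [CompleteSpace E]

theorem adj_anti (a : ℤ → E →L[ℂ] E) (hcar1 : ∀ i j, a i * a j + a j * a i = 0) (i j : ℤ) :
    adjoint (a i) * adjoint (a j) + adjoint (a j) * adjoint (a i) = 0 := by
  have h := congrArg star (hcar1 j i)
  rw [star_add, star_mul, star_mul, star_zero] at h
  exact h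

theorem zeta_anti (a : ℤ → E →L[ℂ] E) (hcar1 : ∀ i j, a i * a j + a j * a i = 0)
    (hcar2 : ∀ i j, adjoint (a i) * a j + a j * adjoint (a i)
        = if i = j then (1 : E →L[ℂ] E) else 0) (i j v w : ℤ) (hij : i ≠ j) :
    zeta a i v * zeta a j w = -(zeta a j w * zeta a i v) := by
  rw [eq_neg_iff_add_eq_zero]
  unfold zeta
  split_ifs
  · exact adj_anti a hcar1 i j
  · rw [hcar2, if_neg hij]
  · rw [add_comm, hcar2, if_neg hij.symm]
  · exact hcar1 i j

theorem zeta_sq (a : ℤ → E →L[ℂ] E) (hcar1 : ∀ i j, a i * a j + a j * a i = 0) (i v : ℤ) :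
    zeta a i v * zeta a i v = 0 := by
  have key : ∀ T : E →L[ℂ] E, T + T = 0 → T = 0 := fun T hT => by
    rw [← two_smul ℂ T] at hT
    exact (smul_eq_zero.1 hT).resolve_left two_ne_zero
  apply key
  unfold zeta
  split_ifs
  · exact adj_anti a hcar1 i i
  · exact hcar1 i i

theorem monomial_mul_zero (a : ℤ → E →L[ℂ] E) (hcar1 : ∀ i j, a i * a j + a j * a i = 0)
    (hcar2 : ∀ i j, adjoint (a i) * a j + a j * adjoint (a i)
        = if i = j then (1 : E →L[ℂ] E) else 0) (k l p q : ℤ) (f g : ℤ → ℤ) (x : ℤ)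
    (hx : x ∈ Finset.Icc (2 * k) (2 * l)) (hx' : x ∈ Finset.Icc (2 * p) (2 * q))
    (hfg : f x = g x) : fermionMonomial a k l f * fermionMonomial a p q g = 0 := by
  have hmem : ∀ (k l : ℤ) (f : ℤ → ℤ), x ∈ Finset.Icc (2 * k) (2 * l) →
      zeta a x (f x) ∈ (List.range ((2 * (l - k)).toNat + 1)).map
        (fun j => zeta a (2 * k + (j : ℤ)) (f (2 * k + (j : ℤ)))) := by
    intro k l f hx
    rw [Finset.mem_Icc] at hx
    refine List.mem_map.2 ⟨x - 2 * k, ?_, ?_⟩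
    · rw [mem_coe_range]; omega
    · have : 2 * k + (x - 2 * k) = x := by omega
      simp only [this]
  have hgood : ∀ (k l : ℤ) (f : ℤ → ℤ), ∀ y ∈ (List.range ((2 * (l - k)).toNat + 1)).map
        (fun j => zeta a (2 * k + (j : ℤ)) (f (2 * k + (j : ℤ)))),
        y = zeta a x (f x) ∨ zeta a x (f x) * y = -(y * zeta a x (f x)) := by
    intro k l f y hy
    obtain ⟨j, -, rfl⟩ := List.mem_map.1 hy
    by_cases h : x = 2 * k + (j : ℤ)
    · left; simp only [← h]
    · right; exact zeta_anti a hcar1 hcar2 _ _ _ _ h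
  refine nil_list_prod_mul (zeta a x (f x)) _ (zeta_sq a hcar1 _ _) ?_ _ (hgood k l f)
    (hmem k l f hx)
  rw [hfg]
  exact nil_list_prod _ (zeta_sq a hcar1 _ _) _ (hgood p q g) (hmem p q g hx')

end

/-- For `f ∈ Ξ̂_{k,l}` and `g ∈ Ξ̂_{p,q}`, if the supporting intervals are
disjoint, or if `f` and `g` agree at some common site, then `𝒬(f)` and `𝒬(g)` anticommute. -/
theorem fermionMonomial_anticommute
    {E : Type*} [NormedAddCommGroup E] [InnerProductSpace ℂ E] [CompleteSpace E]
    (a : ℤ → E →L[ℂ] E)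
    (hcar1 : ∀ i j, a i * a j + a j * a i = 0)
    (hcar2 : ∀ i j, adjoint (a i) * a j + a j * adjoint (a i)
        = if i = j then (1 : E →L[ℂ] E) else 0)
    (k l p q : ℤ) (hkl : k < l) (hpq : p < q)
    (f g : ℤ → ℤ) (hf : IsHatXi k l f) (hg : IsHatXi p q g)
    (hsupp : Finset.Icc (2 * k) (2 * l) ∩ Finset.Icc (2 * p) (2 * q) = ∅ ∨
      ∃ x : ℤ, x ∈ Finset.Icc (2 * k) (2 * l) ∧ x ∈ Finset.Icc (2 * p) (2 * q) ∧ f x = g x) :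
    fermionMonomial a k l f * fermionMonomial a p q g
      + fermionMonomial a p q g * fermionMonomial a k l f = 0 := by
  rcases hsupp with hd | ⟨x, hx, hx', hfg⟩
  · have hodd : ∀ (k l : ℤ) (f : ℤ → ℤ), k < l →
        Odd ((List.range ((2 * (l - k)).toNat + 1)).map
        (fun j => zeta a (2 * k + (j : ℤ)) (f (2 * k + (j : ℤ))))).length := by
      intro k l f h
      rw [List.length_map, length_coe_range]
      exact ⟨(l - k).toNat, by omega⟩
    unfold fermionMonomial
    rw [anti_list_prod_prod _ _ (hodd p q g hpq), (hodd k l f hkl).neg_one_pow]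
    · simp
    · intro y hy w hw
      obtain ⟨i, hi, rfl⟩ := List.mem_map.1 hy
      obtain ⟨j, hj, rfl⟩ := List.mem_map.1 hw
      rw [mem_coe_range] at hi hj
      refine zeta_anti a hcar1 hcar2 _ _ _ _ ?_
      intro e
      have : 2 * k + (i : ℤ) ∈ Finset.Icc (2 * k) (2 * l) ∩ Finset.Icc (2 * p) (2 * q) := by
        rw [Finset.mem_inter, Finset.mem_Icc, Finset.mem_Icc]
        omega
      rw [hd] at this
      simp at this
  · rw [monomial_mul_zero a hcar1 hcar2 k l p q f g x hx hx' hfg,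
      monomial_mul_zero a hcar1 hcar2 p q k l g f x hx' hx hfg.symm, add_zero]
end

section
/- Let k < l be integers and f ∈ Ξ̂_{k,l}. Then for every i ∈ ℤ the local fermion operator 𝒬(f) anticommutes with the local Nicolai supercharge q_i = a_{2i+1} a_{2i}* a_{2i−1} and with its adjoint: q_i 𝒬(f) + 𝒬(f) q_i = 0 and q_i* 𝒬(f) + 𝒬(f) q_i* = 0. Moreover, whenever the triple {2i−1, 2i, 2i+1} has nonempty intersection with {2k,…,2l}, the stronger vanishing holds: q_i 𝒬(f) = 0 = 𝒬(f) q_i and q_i* 𝒬(f) = 0 = 𝒬(f) q_i*. -/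
open ContinuousLinearMap

/-- The local Nicolai supercharge `q_i = a_{2i+1} a_{2i}* a_{2i-1}`. -/
noncomputable def localCharge {E : Type*} [NormedAddCommGroup E] [InnerProductSpace ℂ E]
    [CompleteSpace E] (a : ℤ → E →L[ℂ] E) (i : ℤ) : E →L[ℂ] E :=
  a (2 * i + 1) * adjoint (a (2 * i)) * a (2 * i - 1)

theorem aux_triple_left {R : Type*} [Ring R] (u v w Q : R) (huv : u * v = -(v * u))
    (huw : u * w = -(w * u)) (hvw : v * w = -(w * v))
    (h : u * Q = 0 ∨ v * Q = 0 ∨ w * Q = 0) : u * v * w * Q = 0 := by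
  rcases h with h | h | h
  · have : u * v * w = v * w * u := by
      rw [huv, neg_mul, mul_assoc v u w, huw, mul_neg, neg_neg, mul_assoc]
    rw [this, mul_assoc, h, mul_zero]
  · rw [mul_assoc u v w, hvw, mul_neg, neg_mul, mul_assoc, mul_assoc, h]
    simp
  · rw [mul_assoc, h, mul_zero]

theorem aux_triple_right {R : Type*} [Ring R] (u v w Q : R) (huv : u * v = -(v * u))
    (huw : u * w = -(w * u)) (hvw : v * w = -(w * v))
    (h : Q * u = 0 ∨ Q * v = 0 ∨ Q * w = 0) : Q * (u * v * w) = 0 := by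
  rcases h with h | h | h
  · rw [mul_assoc, ← mul_assoc, h, zero_mul]
  · rw [huv, neg_mul, mul_neg, mul_assoc, ← mul_assoc, h]
    simp
  · have : u * v * w = w * (u * v) := by
      rw [mul_assoc u v w, hvw, mul_neg, ← mul_assoc, huw, neg_mul, neg_neg, mul_assoc]
    rw [this, ← mul_assoc, h, zero_mul]

theorem aux_prod_comm {R : Type*} [Ring R] (x : R) (L : List R)
    (h : ∀ y ∈ L, x * y = -(y * x)) : x * L.prod = (-1) ^ L.length * (L.prod * x) := by
  induction L with
  | nil => simp
  | cons y L ih =>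
    have h1 := h y (by simp)
    have h2 := ih (fun z hz => h z (by simp [hz]))
    have h3 : y * (-1) ^ L.length = (-1) ^ L.length * y :=
      ((Commute.neg_one_right y).pow_right _).eq
    rw [List.prod_cons, List.length_cons, ← mul_assoc, h1, neg_mul, mul_assoc, h2,
      ← mul_assoc y, h3, pow_succ]
    simp [mul_assoc]

theorem aux_prod_zero {R : Type*} [Ring R] (x : R) (L : List R)
    (h : ∀ y ∈ L, x * y = -(y * x)) (hx : x * x = 0) (hm : x ∈ L) :
    x * L.prod = 0 ∧ L.prod * x = 0 := by
  have key : x * L.prod = 0 := by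
    induction L with
    | nil => simp at hm
    | cons y L ih =>
      rw [List.prod_cons, ← mul_assoc]
      rcases List.mem_cons.1 hm with rfl | hm
      · rw [hx, zero_mul]
      · rw [h y (by simp), neg_mul, mul_assoc, ih (fun z hz => h z (by simp [hz])) hm]
        simp
  refine ⟨key, ?_⟩
  have h2 := aux_prod_comm x L h
  rw [key] at h2
  rcases neg_one_pow_eq_or R L.length with h3 | h3 <;> rw [h3] at h2 <;> simpa using h2.symm

section
variable {E : Type*} [NormedAddCommGroup E] [InnerProductSpace ℂ E] [CompleteSpace E]

theorem aux_zeta_anti (a : ℤ → E →L[ℂ] E)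
    (hcar1 : ∀ i j, a i * a j + a j * a i = 0)
    (hcar2 : ∀ i j, adjoint (a i) * a j + a j * adjoint (a i)
        = if i = j then (1 : E →L[ℂ] E) else 0)
    (i j s t : ℤ) (hij : i ≠ j) : zeta a i s * zeta a j t = -(zeta a j t * zeta a i s) := by
  have h3 : adjoint (a i) * adjoint (a j) + adjoint (a j) * adjoint (a i) = 0 := by
    have h := congrArg star (hcar1 j i)
    simpa [star_add, star_mul, star_eq_adjoint] using h
  have h1 := hcar2 i j
  have h2 := hcar2 j i
  rw [if_neg hij] at h1
  rw [if_neg hij.symm, add_comm] at h2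
  unfold zeta
  apply eq_neg_of_add_eq_zero_left
  split_ifs
  · exact h3
  · exact h1
  · exact h2
  · exact hcar1 i j

theorem aux_zeta_sq (a : ℤ → E →L[ℂ] E)
    (hcar1 : ∀ i j, a i * a j + a j * a i = 0)
    (i s : ℤ) : zeta a i s * zeta a i s = 0 := by
  have h0 : a i * a i = 0 := by
    have h := hcar1 i i
    rw [← two_smul ℂ] at h
    exact (smul_eq_zero.1 h).resolve_left two_ne_zero
  have h3 : adjoint (a i) * adjoint (a i) = 0 := by
    have h := congrArg star h0
    simpa [star_mul, star_eq_adjoint] using h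
  unfold zeta
  split_ifs
  · exact h3
  · exact h0

theorem aux_charge (a : ℤ → E →L[ℂ] E) (i : ℤ) :
    localCharge a i = zeta a (2 * i + 1) (-1) * zeta a (2 * i) 1 * zeta a (2 * i - 1) (-1) := by
  simp [localCharge, zeta]

theorem aux_charge_adj (a : ℤ → E →L[ℂ] E) (i : ℤ) :
    adjoint (localCharge a i)
      = zeta a (2 * i - 1) 1 * zeta a (2 * i) (-1) * zeta a (2 * i + 1) 1 := by
  rw [← star_eq_adjoint]
  simp [localCharge, zeta, star_mul, star_eq_adjoint, mul_assoc]

theorem aux_mono_eq (a : ℤ → E →L[ℂ] E) (k l : ℤ) (f : ℤ → ℤ) :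
    fermionMonomial a k l f = ((List.range ((2 * (l - k)).toNat + 1)).map
      (fun j : ℕ => zeta a (2 * k + (j : ℤ)) (f (2 * k + (j : ℤ))))).prod := by
  unfold fermionMonomial
  congr 1
  simp [← List.map_eq_flatMap, Function.comp_def]

theorem aux_mono_zero (a : ℤ → E →L[ℂ] E)
    (hcar1 : ∀ i j, a i * a j + a j * a i = 0)
    (hcar2 : ∀ i j, adjoint (a i) * a j + a j * adjoint (a i)
        = if i = j then (1 : E →L[ℂ] E) else 0)
    (k l : ℤ) (f : ℤ → ℤ) (m s : ℤ) (hm : 2 * k ≤ m ∧ m ≤ 2 * l) (hs : f m = s) :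
    zeta a m s * fermionMonomial a k l f = 0 ∧ fermionMonomial a k l f * zeta a m s = 0 := by
  subst hs
  rw [aux_mono_eq]
  apply aux_prod_zero
  · intro y hy
    obtain ⟨j, -, rfl⟩ := List.mem_map.1 hy
    by_cases h : m = 2 * k + (j : ℤ)
    · rw [← h, aux_zeta_sq a hcar1, neg_zero]
    · exact aux_zeta_anti a hcar1 hcar2 _ _ _ _ h
  · exact aux_zeta_sq a hcar1 _ _
  · refine List.mem_map.2 ⟨(m - 2 * k).toNat, ?_, ?_⟩
    · rw [List.mem_range]; omega
    · have : 2 * k + ((m - 2 * k).toNat : ℤ) = m := by omega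
      simp only [this]

theorem aux_mono_anti (a : ℤ → E →L[ℂ] E)
    (hcar1 : ∀ i j, a i * a j + a j * a i = 0)
    (hcar2 : ∀ i j, adjoint (a i) * a j + a j * adjoint (a i)
        = if i = j then (1 : E →L[ℂ] E) else 0)
    (k l : ℤ) (hkl : k < l) (f : ℤ → ℤ) (m s : ℤ) (hm : m < 2 * k ∨ 2 * l < m) :
    zeta a m s * fermionMonomial a k l f = -(fermionMonomial a k l f * zeta a m s) := by
  rw [aux_mono_eq]
  rw [aux_prod_comm]
  · rw [List.length_map, List.length_range, Odd.neg_one_pow, neg_one_mul]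
    exact ⟨(l - k).toNat, by omega⟩
  · intro y hy
    obtain ⟨j, hj, rfl⟩ := List.mem_map.1 hy
    rw [List.mem_range] at hj
    exact aux_zeta_anti a hcar1 hcar2 _ _ _ _ (by omega)

theorem aux_triple_anti {R : Type*} [Ring R] (u v w Q : R) (hu : u * Q = -(Q * u))
    (hv : v * Q = -(Q * v)) (hw : w * Q = -(Q * w)) :
    u * v * w * Q + Q * (u * v * w) = 0 := by
  have : u * v * w * Q = -(Q * (u * v * w)) := by
    rw [mul_assoc, hw, mul_neg, ← mul_assoc, mul_assoc u v Q, hv, mul_neg, ← mul_assoc, hu]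
    simp [mul_assoc]
  rw [this, neg_add_cancel]

/-- Combinatorial core: one of the three sites carries a matching factor. -/
theorem aux_comb (k l : ℤ) (hkl : k < l) (f : ℤ → ℤ) (hf : IsHatXi k l f) (i s : ℤ)
    (hs : s = 1 ∨ s = -1) (h1 : k ≤ i) (h2 : i ≤ l) :
    (2 * k ≤ 2 * i + 1 ∧ 2 * i + 1 ≤ 2 * l ∧ f (2 * i + 1) = -s) ∨
    (2 * k ≤ 2 * i ∧ 2 * i ≤ 2 * l ∧ f (2 * i) = s) ∨
    (2 * k ≤ 2 * i - 1 ∧ 2 * i - 1 ≤ 2 * l ∧ f (2 * i - 1) = -s) := by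
  obtain ⟨hv, hn, hk, hl⟩ := hf
  have v0 := hv (2 * i) (by rw [Finset.mem_Icc]; omega)
  by_cases c1 : i = k
  · subst c1
    omega
  by_cases c2 : i = l
  · subst c2
    omega
  have v1 := hv (2 * i + 1) (by rw [Finset.mem_Icc]; omega)
  have v2 := hv (2 * i - 1) (by rw [Finset.mem_Icc]; omega)
  by_contra hc
  apply hn
  refine ⟨i, by omega, by omega, ?_⟩
  omega

end

/-- For `k < l` and `f ∈ Ξ̂_{k,l}`, the operator `𝒬(f)` anticommutes with
every local Nicolai supercharge `q_i` and its adjoint; moreover when the triple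
`{2i-1, 2i, 2i+1}` meets `{2k,…,2l}` all four products vanish. -/
theorem fermionMonomial_anticommutes_with_localCharges
    {E : Type*} [NormedAddCommGroup E] [InnerProductSpace ℂ E] [CompleteSpace E]
    (a : ℤ → E →L[ℂ] E)
    (hcar1 : ∀ i j, a i * a j + a j * a i = 0)
    (hcar2 : ∀ i j, adjoint (a i) * a j + a j * adjoint (a i)
        = if i = j then (1 : E →L[ℂ] E) else 0)
    (k l : ℤ) (hkl : k < l) (f : ℤ → ℤ) (hf : IsHatXi k l f) :
    (∀ i : ℤ,
      localCharge a i * fermionMonomial a k l f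
          + fermionMonomial a k l f * localCharge a i = 0 ∧
      adjoint (localCharge a i) * fermionMonomial a k l f
          + fermionMonomial a k l f * adjoint (localCharge a i) = 0) ∧
    (∀ i : ℤ, (∃ x ∈ ({2 * i - 1, 2 * i, 2 * i + 1} : Set ℤ),
        x ∈ Finset.Icc (2 * k) (2 * l)) →
      localCharge a i * fermionMonomial a k l f = 0 ∧
      fermionMonomial a k l f * localCharge a i = 0 ∧
      adjoint (localCharge a i) * fermionMonomial a k l f = 0 ∧
      fermionMonomial a k l f * adjoint (localCharge a i) = 0) := by
  have Z : ∀ i : ℤ, k ≤ i → i ≤ l →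
      localCharge a i * fermionMonomial a k l f = 0 ∧
      fermionMonomial a k l f * localCharge a i = 0 ∧
      adjoint (localCharge a i) * fermionMonomial a k l f = 0 ∧
      fermionMonomial a k l f * adjoint (localCharge a i) = 0 := by
    intro i h1 h2
    have A := fun (m n s t : ℤ) (h : m ≠ n) => aux_zeta_anti a hcar1 hcar2 m n s t h
    have M := aux_mono_zero a hcar1 hcar2 k l f
    have C1 := aux_comb k l hkl f hf i 1 (Or.inl rfl) h1 h2
    have C2 := aux_comb k l hkl f hf i (-1) (Or.inr rfl) h1 h2
    rw [neg_neg] at C2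
    rw [aux_charge_adj, aux_charge]
    refine ⟨?_, ?_, ?_, ?_⟩
    · apply aux_triple_left _ _ _ _ (A _ _ _ _ (by omega)) (A _ _ _ _ (by omega))
        (A _ _ _ _ (by omega))
      rcases C1 with ⟨p, q, r⟩ | ⟨p, q, r⟩ | ⟨p, q, r⟩
      · exact Or.inl (M _ _ ⟨p, q⟩ r).1
      · exact Or.inr (Or.inl (M _ _ ⟨p, q⟩ r).1)
      · exact Or.inr (Or.inr (M _ _ ⟨p, q⟩ r).1)
    · apply aux_triple_right _ _ _ _ (A _ _ _ _ (by omega)) (A _ _ _ _ (by omega))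
        (A _ _ _ _ (by omega))
      rcases C1 with ⟨p, q, r⟩ | ⟨p, q, r⟩ | ⟨p, q, r⟩
      · exact Or.inl (M _ _ ⟨p, q⟩ r).2
      · exact Or.inr (Or.inl (M _ _ ⟨p, q⟩ r).2)
      · exact Or.inr (Or.inr (M _ _ ⟨p, q⟩ r).2)
    · apply aux_triple_left _ _ _ _ (A _ _ _ _ (by omega)) (A _ _ _ _ (by omega))
        (A _ _ _ _ (by omega))
      rcases C2 with ⟨p, q, r⟩ | ⟨p, q, r⟩ | ⟨p, q, r⟩
      · exact Or.inr (Or.inr (M _ _ ⟨p, q⟩ r).1)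
      · exact Or.inr (Or.inl (M _ _ ⟨p, q⟩ r).1)
      · exact Or.inl (M _ _ ⟨p, q⟩ r).1
    · apply aux_triple_right _ _ _ _ (A _ _ _ _ (by omega)) (A _ _ _ _ (by omega))
        (A _ _ _ _ (by omega))
      rcases C2 with ⟨p, q, r⟩ | ⟨p, q, r⟩ | ⟨p, q, r⟩
      · exact Or.inr (Or.inr (M _ _ ⟨p, q⟩ r).2)
      · exact Or.inr (Or.inl (M _ _ ⟨p, q⟩ r).2)
      · exact Or.inl (M _ _ ⟨p, q⟩ r).2
  constructor
  · intro i
    by_cases h : k ≤ i ∧ i ≤ l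
    · obtain ⟨p1, p2, p3, p4⟩ := Z i h.1 h.2
      rw [p1, p2, p3, p4, add_zero]
      exact ⟨rfl, rfl⟩
    · have N := aux_mono_anti a hcar1 hcar2 k l hkl f
      rw [aux_charge_adj, aux_charge]
      exact ⟨aux_triple_anti _ _ _ _ (N _ _ (by omega)) (N _ _ (by omega)) (N _ _ (by omega)),
        aux_triple_anti _ _ _ _ (N _ _ (by omega)) (N _ _ (by omega)) (N _ _ (by omega))⟩
  · rintro i ⟨x, hx, hx2⟩
    rw [Finset.mem_Icc] at hx2
    simp only [Set.mem_insert_iff, Set.mem_singleton_iff] at hx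
    exact Z i (by omega) (by omega)
end

section
/- Let m be a positive even integer, Λ = ℤ/(2m+2)ℤ, (a_x)_{x∈Λ} a CAR family, Q = Σ_{x∈Λ, x even} a_{x+1} a_x* a_{x−1} the finite-volume Nicolai supercharge and H = QQ* + Q*Q. Let f : Λ → {−1,+1} be permitted, i.e. for no even residue x does (f(x−1), f(x), f(x+1)) equal (−1,+1,−1) or (+1,−1,+1), and let 𝒬(f) = ζ_{−m−1}(f(−m−1)) ζ_{−m}(f(−m)) ⋯ ζ_{m}(f(m)) be the product over all sites in the order of the representatives −m−1, −m, …, m, where ζ_x(−1) = a_x and ζ_x(+1) = a_x*. Then Q𝒬(f) = 0 = 𝒬(f)Q and Q*𝒬(f) = 0 = 𝒬(f)Q*, and consequently H𝒬(f) = 𝒬(f)H: every such 𝒬(f) is a constant of motion for the finite-volume Nicolai model with periodic boundary conditions. -/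
open ContinuousLinearMap

/-- `ζ_x(-1) = a_x`, `ζ_x(+1) = a_x*` on the periodic chain. -/
noncomputable def zetaP {E : Type*} [NormedAddCommGroup E] [InnerProductSpace ℂ E]
    [CompleteSpace E] (m : ℕ) (a : ZMod (2 * m + 2) → E →L[ℂ] E)
    (x : ZMod (2 * m + 2)) (v : ℤ) : E →L[ℂ] E :=
  if v = 1 then adjoint (a x) else a x

/-- `𝒬(f) = ζ_{-m-1}(f(-m-1)) ζ_{-m}(f(-m)) ⋯ ζ_{m}(f(m))`, the product over all sites of
the periodic chain, taken in the order of the representatives `-m-1, -m, …, m`: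
the `j`-th factor sits at the residue `j - (m+1)`. -/
noncomputable def fermionMonomialP {E : Type*} [NormedAddCommGroup E] [InnerProductSpace ℂ E]
    [CompleteSpace E] (m : ℕ) (a : ZMod (2 * m + 2) → E →L[ℂ] E)
    (f : ZMod (2 * m + 2) → ℤ) : E →L[ℂ] E :=
  ((List.range (2 * m + 2)).map
    (fun j => zetaP m a ((j : ZMod (2 * m + 2)) - ((m : ZMod (2 * m + 2)) + 1))
      (f ((j : ZMod (2 * m + 2)) - ((m : ZMod (2 * m + 2)) + 1))))).prod

lemma list_prod_anti {R : Type*} [Ring R] (b : R) (hb : b * b = 0) (L : List R)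
    (hL : ∀ c ∈ L, b * c = -(c * b)) (hmem : b ∈ L) : b * L.prod = 0 ∧ L.prod * b = 0 := by
  have comm : ∀ L : List R, (∀ c ∈ L, b * c = -(c * b)) →
      L.prod * b = b * L.prod ∨ L.prod * b = -(b * L.prod) := by
    intro L
    induction L with
    | nil => intro _; left; simp
    | cons c L ih =>
      intro h
      have hc := h c (by simp)
      have hc' : c * b = -(b * c) := by rw [hc, neg_neg]
      rcases ih (fun d hd => h d (by simp [hd])) with h1 | h1
      · right
        rw [List.prod_cons, mul_assoc, h1, ← mul_assoc, hc', neg_mul, mul_assoc]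
      · left
        rw [List.prod_cons, mul_assoc, h1, mul_neg, ← mul_assoc, hc', neg_mul, neg_neg, mul_assoc]
  have left : b * L.prod = 0 := by
    clear comm
    induction L with
    | nil => simp at hmem
    | cons c L ih =>
      have hc := hL c (by simp)
      rcases List.mem_cons.1 hmem with h | h
      · subst h
        rw [List.prod_cons, ← mul_assoc, hb, zero_mul]
      · rw [List.prod_cons, ← mul_assoc, hc, neg_mul, mul_assoc,
          ih (fun d hd => hL d (by simp [hd])) h, mul_zero, neg_zero]
  refine ⟨left, ?_⟩
  rcases comm L hL with h | h <;> rw [h, left]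
  simp

lemma triple_left {R : Type*} [Ring R] (p q r M : R) (hpq : p * q = -(q * p))
    (hpr : p * r = -(r * p)) (hqr : q * r = -(r * q))
    (h : p * M = 0 ∨ q * M = 0 ∨ r * M = 0) : p * q * r * M = 0 := by
  rcases h with h | h | h
  · have : p * q * r = q * r * p := by
      rw [hpq, neg_mul, mul_assoc, hpr, mul_neg, neg_neg, mul_assoc]
    rw [this, mul_assoc, h, mul_zero]
  · rw [mul_assoc p, hqr, mul_neg, neg_mul, ← mul_assoc, mul_assoc _ q, h, mul_zero, neg_zero]
  · rw [mul_assoc, h, mul_zero]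

lemma triple_right {R : Type*} [Ring R] (p q r M : R) (hpq : p * q = -(q * p))
    (hpr : p * r = -(r * p)) (hqr : q * r = -(r * q))
    (h : M * p = 0 ∨ M * q = 0 ∨ M * r = 0) : M * (p * q * r) = 0 := by
  rcases h with h | h | h
  · rw [mul_assoc, ← mul_assoc, h, zero_mul]
  · rw [hpq, neg_mul, mul_neg, mul_assoc, ← mul_assoc, h, zero_mul, neg_zero]
  · have : p * q * r = r * (p * q) := by
      rw [mul_assoc, hqr, mul_neg, ← mul_assoc, hpr, neg_mul, neg_neg, mul_assoc]
    rw [this, ← mul_assoc, h, zero_mul]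

set_option maxHeartbeats 2000000

/-- Let `f : Λ → {±1}` be permitted (no forbidden triplet
`(-1,+1,-1)` or `(+1,-1,+1)` centered at an even residue). Then the associated fermion
monomial `𝒬(f)` satisfies `Q𝒬(f) = 0 = 𝒬(f)Q`, `Q*𝒬(f) = 0 = 𝒬(f)Q*`, and hence commutes
with the finite-volume Nicolai Hamiltonian `H = QQ* + Q*Q`. -/
theorem fermionMonomialP_constant_of_motion
    {E : Type*} [NormedAddCommGroup E] [InnerProductSpace ℂ E] [CompleteSpace E]
    (m : ℕ) (hm : 0 < m) (hme : Even m) (a : ZMod (2 * m + 2) → E →L[ℂ] E)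
    (hcar1 : ∀ x y, a x * a y + a y * a x = 0)
    (hcar2 : ∀ x y, adjoint (a x) * a y + a y * adjoint (a x)
        = if x = y then (1 : E →L[ℂ] E) else 0)
    (f : ZMod (2 * m + 2) → ℤ)
    (hval : ∀ x, f x = 1 ∨ f x = -1)
    (hperm : ∀ x : ZMod (2 * m + 2), Even x.val →
      ¬ ((f (x - 1) = -1 ∧ f x = 1 ∧ f (x + 1) = -1) ∨
         (f (x - 1) = 1 ∧ f x = -1 ∧ f (x + 1) = 1))) :
    nicolaiCharge m a * fermionMonomialP m a f = 0 ∧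
    fermionMonomialP m a f * nicolaiCharge m a = 0 ∧
    adjoint (nicolaiCharge m a) * fermionMonomialP m a f = 0 ∧
    fermionMonomialP m a f * adjoint (nicolaiCharge m a) = 0 ∧
    (nicolaiCharge m a * adjoint (nicolaiCharge m a)
        + adjoint (nicolaiCharge m a) * nicolaiCharge m a) * fermionMonomialP m a f
      = fermionMonomialP m a f *
        (nicolaiCharge m a * adjoint (nicolaiCharge m a)
          + adjoint (nicolaiCharge m a) * nicolaiCharge m a) := by
  classical
  have hadj : ∀ A B : E →L[ℂ] E, adjoint (A * B) = adjoint B * adjoint A :=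
    fun A B => ContinuousLinearMap.adjoint_comp A B
  have h11 : ∀ x y, a x * a y = -(a y * a x) := fun x y => eq_neg_of_add_eq_zero_left (hcar1 x y)
  have h22 : ∀ x y, adjoint (a x) * adjoint (a y) = -(adjoint (a y) * adjoint (a x)) := by
    intro x y
    have h := congrArg (fun A => adjoint A) (h11 y x)
    simpa only [hadj, map_neg] using h
  have h21 : ∀ x y, x ≠ y → adjoint (a x) * a y = -(a y * adjoint (a x)) := by
    intro x y hxy
    have h := hcar2 x y
    rw [if_neg hxy] at h
    exact eq_neg_of_add_eq_zero_left h
  have h12 : ∀ x y, x ≠ y → a x * adjoint (a y) = -(adjoint (a y) * a x) := by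
    intro x y hxy
    rw [h21 y x hxy.symm, neg_neg]
  have hz : ∀ x y, zetaP m a x (f x) * zetaP m a y (f y)
      = -(zetaP m a y (f y) * zetaP m a x (f x)) := by
    intro x y
    by_cases hxy : x = y
    · subst hxy
      unfold zetaP
      split_ifs
      · exact h22 x x
      · exact h11 x x
    · unfold zetaP
      split_ifs
      · exact h22 x y
      · exact h21 x y hxy
      · exact h12 x y hxy
      · exact h11 x y
  have hM : ∀ x, zetaP m a x (f x) * fermionMonomialP m a f = 0 ∧
      fermionMonomialP m a f * zetaP m a x (f x) = 0 := by
    intro x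
    have hsq : zetaP m a x (f x) * zetaP m a x (f x) = 0 := by
      have h2 : (2 : ℂ) • (zetaP m a x (f x) * zetaP m a x (f x)) = 0 := by
        rw [two_smul]
        exact eq_neg_iff_add_eq_zero.1 (hz x x)
      exact (smul_eq_zero.1 h2).resolve_left two_ne_zero
    refine list_prod_anti _ hsq _ ?_ ?_
    · intro c hc
      obtain ⟨j, -, rfl⟩ := List.mem_map.1 hc
      exact hz _ _
    · refine List.mem_map.2 ⟨x + ((m : ZMod (2 * m + 2)) + 1), ?_, ?_⟩
      · simp only [List.bind_eq_flatMap, List.pure_def, List.mem_flatMap, List.mem_range,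
          List.mem_singleton]
        exact ⟨(x + ((m : ZMod (2 * m + 2)) + 1)).val, ZMod.val_lt _,
          (ZMod.natCast_zmod_val _).symm⟩
      · simp only [add_sub_cancel_right]
  have hMm : ∀ x, f x = -1 → a x * fermionMonomialP m a f = 0 ∧
      fermionMonomialP m a f * a x = 0 := by
    intro x hx
    have h := hM x
    rw [hx] at h
    simpa [zetaP] using h
  have hMp : ∀ x, f x = 1 → adjoint (a x) * fermionMonomialP m a f = 0 ∧
      fermionMonomialP m a f * adjoint (a x) = 0 := by
    intro x hx
    have h := hM x
    rw [hx] at h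
    simpa [zetaP] using h
  have h1 : (1 : ZMod (2 * m + 2)) ≠ 0 := by
    intro h
    have := (ZMod.natCast_eq_zero_iff 1 (2 * m + 2)).1 (by exact_mod_cast h)
    have := Nat.le_of_dvd (by norm_num) this
    omega
  have d1 : ∀ x : ZMod (2 * m + 2), x + 1 ≠ x := fun x h => h1 (by simpa using h)
  have d2 : ∀ x : ZMod (2 * m + 2), x ≠ x - 1 := fun x h => h1 (by simpa using h.symm)
  have cases1 : ∀ x : ZMod (2 * m + 2), Even x.val →
      f (x + 1) = -1 ∨ f x = 1 ∨ f (x - 1) = -1 := by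
    intro x hx
    have := hperm x hx
    have := hval (x + 1)
    have := hval x
    have := hval (x - 1)
    tauto
  have cases2 : ∀ x : ZMod (2 * m + 2), Even x.val →
      f (x - 1) = 1 ∨ f x = -1 ∨ f (x + 1) = 1 := by
    intro x hx
    have := hperm x hx
    have := hval (x + 1)
    have := hval x
    have := hval (x - 1)
    tauto
  have hQs : adjoint (nicolaiCharge m a) =
      ∑ x ∈ Finset.univ.filter (fun x : ZMod (2 * m + 2) => Even x.val),
        adjoint (a (x - 1)) * a x * adjoint (a (x + 1)) := by
    unfold nicolaiCharge
    rw [map_sum]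
    refine Finset.sum_congr rfl fun x _ => ?_
    rw [hadj, hadj, adjoint_adjoint, mul_assoc]
  have e1 : nicolaiCharge m a * fermionMonomialP m a f = 0 := by
    unfold nicolaiCharge
    rw [Finset.sum_mul]
    refine Finset.sum_eq_zero fun x hx => ?_
    refine triple_left _ _ _ _ (h12 _ _ (d1 x)) (h11 _ _) (h21 _ _ (d2 x)) ?_
    exact (cases1 x (Finset.mem_filter.1 hx).2).imp (fun h => (hMm _ h).1)
      (Or.imp (fun h => (hMp _ h).1) (fun h => (hMm _ h).1))
  have e2 : fermionMonomialP m a f * nicolaiCharge m a = 0 := by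
    unfold nicolaiCharge
    rw [Finset.mul_sum]
    refine Finset.sum_eq_zero fun x hx => ?_
    refine triple_right _ _ _ _ (h12 _ _ (d1 x)) (h11 _ _) (h21 _ _ (d2 x)) ?_
    exact (cases1 x (Finset.mem_filter.1 hx).2).imp (fun h => (hMm _ h).2)
      (Or.imp (fun h => (hMp _ h).2) (fun h => (hMm _ h).2))
  have e3 : adjoint (nicolaiCharge m a) * fermionMonomialP m a f = 0 := by
    rw [hQs, Finset.sum_mul]
    refine Finset.sum_eq_zero fun x hx => ?_
    refine triple_left _ _ _ _ (h21 _ _ (d2 x).symm) (h22 _ _) (h12 _ _ (d1 x).symm) ?_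
    exact (cases2 x (Finset.mem_filter.1 hx).2).imp (fun h => (hMp _ h).1)
      (Or.imp (fun h => (hMm _ h).1) (fun h => (hMp _ h).1))
  have e4 : fermionMonomialP m a f * adjoint (nicolaiCharge m a) = 0 := by
    rw [hQs, Finset.mul_sum]
    refine Finset.sum_eq_zero fun x hx => ?_
    refine triple_right _ _ _ _ (h21 _ _ (d2 x).symm) (h22 _ _) (h12 _ _ (d1 x).symm) ?_
    exact (cases2 x (Finset.mem_filter.1 hx).2).imp (fun h => (hMp _ h).2)
      (Or.imp (fun h => (hMm _ h).2) (fun h => (hMp _ h).2))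
  refine ⟨e1, e2, e3, e4, ?_⟩
  rw [add_mul, mul_add, mul_assoc, mul_assoc, e1, e3, ← mul_assoc, ← mul_assoc, e2, e4]
  simp
end

section
/- Let p, q ≥ 2 be integers, Λ₂ = (ℤ/2pℤ) × (ℤ/2qℤ), and let (a_v)_{v∈Λ₂} be a CAR family on a complex Hilbert space. Then the two-dimensional Nicolai supercharge Q = Σ_{(x,y)∈Λ₂, x even, y even} a_{(x−1,y)} a_{(x,y−1)} a_{(x,y)}* a_{(x+1,y)} a_{(x,y+1)} is nilpotent: Q² = 0 and (Q*)² = 0. -/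
open ContinuousLinearMap

instance (p : ℕ) [NeZero p] : NeZero (2 * p) :=
  ⟨by have := NeZero.ne p; omega⟩

/-- The two-dimensional Nicolai supercharge on `Λ₂ = (ℤ/2pℤ) × (ℤ/2qℤ)`:
`Q = Σ_{(x,y) even-even} a_{(x-1,y)} a_{(x,y-1)} a_{(x,y)}* a_{(x+1,y)} a_{(x,y+1)}`. -/
noncomputable def nicolaiCharge2D {E : Type*} [NormedAddCommGroup E] [InnerProductSpace ℂ E]
    [CompleteSpace E] (p q : ℕ) [NeZero p] [NeZero q]
    (a : ZMod (2 * p) × ZMod (2 * q) → E →L[ℂ] E) : E →L[ℂ] E :=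
  ∑ v ∈ Finset.univ.filter
      (fun v : ZMod (2 * p) × ZMod (2 * q) => Even v.1.val ∧ Even v.2.val),
    a (v.1 - 1, v.2) * a (v.1, v.2 - 1) * adjoint (a v) * a (v.1 + 1, v.2) * a (v.1, v.2 + 1)

theorem nic_ac5 {R : Type*} [Ring R] {x a b c d e : R} (ha : x * a = -(a * x))
    (hb : x * b = -(b * x)) (hc : x * c = -(c * x)) (hd : x * d = -(d * x))
    (he : x * e = -(e * x)) :
    x * (a * b * c * d * e) = -(a * b * c * d * e * x) := by
  calc x * (a * b * c * d * e) = (x * a) * b * c * d * e := by simp only [mul_assoc]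
    _ = -(a * (x * b) * c * d * e) := by rw [ha]; simp only [mul_assoc, neg_mul]
    _ = a * b * (x * c) * d * e := by rw [hb]; simp only [mul_assoc, neg_mul, mul_neg, neg_neg]
    _ = -(a * b * c * (x * d) * e) := by rw [hc]; simp only [mul_assoc, neg_mul, mul_neg]
    _ = a * b * c * d * (x * e) := by rw [hd]; simp only [mul_assoc, neg_mul, mul_neg, neg_neg]
    _ = _ := by rw [he]; simp only [mul_assoc, mul_neg]

theorem nic_ac_symm {R : Type*} [Ring R] {x y : R} (h : x * y = -(y * x)) :
    y * x = -(x * y) := by rw [h, neg_neg]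

theorem nic_even_cast (p : ℕ) [NeZero p] (x : ZMod (2 * p)) (h : Even x.val) :
    ZMod.castHom (Dvd.intro p rfl : 2 ∣ 2 * p) (ZMod 2) x = 0 := by
  rw [ZMod.castHom_apply, ZMod.cast_eq_val]
  exact (ZMod.natCast_eq_zero_iff_even).2 h

theorem nic_ne_add (p : ℕ) [NeZero p] (x y : ZMod (2 * p)) (hx : Even x.val) (hy : Even y.val) :
    x ≠ y + 1 := by
  intro h
  have := congrArg (ZMod.castHom (Dvd.intro p rfl : 2 ∣ 2 * p) (ZMod 2)) h
  rw [map_add, map_one, nic_even_cast p x hx, nic_even_cast p y hy] at this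
  exact absurd this (by decide)

theorem nic_ne_sub (p : ℕ) [NeZero p] (x y : ZMod (2 * p)) (hx : Even x.val) (hy : Even y.val) :
    x ≠ y - 1 := by
  intro h
  exact nic_ne_add p y x hy hx (by rw [h]; ring)

/-- For integers `p, q ≥ 2` and a CAR family on
`Λ₂ = (ℤ/2pℤ) × (ℤ/2qℤ)`, the two-dimensional Nicolai supercharge is nilpotent:
`Q² = 0` and `(Q*)² = 0`. -/
theorem nicolai2D_supercharge_nilpotent
    {E : Type*} [NormedAddCommGroup E] [InnerProductSpace ℂ E] [CompleteSpace E]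
    (p q : ℕ) [NeZero p] [NeZero q] (hp : 2 ≤ p) (hq : 2 ≤ q)
    (a : ZMod (2 * p) × ZMod (2 * q) → E →L[ℂ] E)
    (hcar1 : ∀ u v, a u * a v + a v * a u = 0)
    (hcar2 : ∀ u v, adjoint (a u) * a v + a v * adjoint (a u)
        = if u = v then (1 : E →L[ℂ] E) else 0) :
    nicolaiCharge2D p q a ^ 2 = 0 ∧ adjoint (nicolaiCharge2D p q a) ^ 2 = 0 := by
  have h1 : ∀ u v, a u * a v = -(a v * a u) := fun u v => eq_neg_of_add_eq_zero_left (hcar1 u v)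
  have h2 : ∀ u v, adjoint (a u) * adjoint (a v) = -(adjoint (a v) * adjoint (a u)) := by
    intro u v
    have := congrArg star (h1 v u)
    simpa only [star_neg, star_mul, star_eq_adjoint] using this
  have h3 : ∀ u v, u ≠ v → adjoint (a u) * a v = -(a v * adjoint (a u)) := by
    intro u v huv
    have := hcar2 u v
    rw [if_neg huv] at this
    exact eq_neg_of_add_eq_zero_left this
  have key : nicolaiCharge2D p q a * nicolaiCharge2D p q a
      = -(nicolaiCharge2D p q a * nicolaiCharge2D p q a) := by
    unfold nicolaiCharge2D
    conv_rhs => rw [Finset.sum_mul_sum, Finset.sum_comm]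
    rw [Finset.sum_mul_sum, ← Finset.sum_neg_distrib]
    refine Finset.sum_congr rfl fun v hv => ?_
    rw [← Finset.sum_neg_distrib]
    refine Finset.sum_congr rfl fun w hw => ?_
    obtain ⟨hv1, hv2⟩ := (Finset.mem_filter.1 hv).2
    obtain ⟨hw1, hw2⟩ := (Finset.mem_filter.1 hw).2
    have n1 : ∀ v w : ZMod (2 * p) × ZMod (2 * q), Even v.1.val → Even w.1.val →
        v ≠ (w.1 + 1, w.2) ∧ v ≠ (w.1 - 1, w.2) := fun v w h h' =>
      ⟨fun e => nic_ne_add p _ _ h h' (congrArg Prod.fst e),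
        fun e => nic_ne_sub p _ _ h h' (congrArg Prod.fst e)⟩
    have n2 : ∀ v w : ZMod (2 * p) × ZMod (2 * q), Even v.2.val → Even w.2.val →
        v ≠ (w.1, w.2 + 1) ∧ v ≠ (w.1, w.2 - 1) := fun v w h h' =>
      ⟨fun e => nic_ne_add q _ _ h h' (congrArg Prod.snd e),
        fun e => nic_ne_sub q _ _ h h' (congrArg Prod.snd e)⟩
    have outer : ∀ u, w ≠ u → a u * (a (w.1 - 1, w.2) * a (w.1, w.2 - 1) * adjoint (a w) *
        a (w.1 + 1, w.2) * a (w.1, w.2 + 1)) = -(a (w.1 - 1, w.2) * a (w.1, w.2 - 1) *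
        adjoint (a w) * a (w.1 + 1, w.2) * a (w.1, w.2 + 1) * a u) := fun u hu =>
      nic_ac5 (h1 _ _) (h1 _ _) (nic_ac_symm (h3 _ _ hu)) (h1 _ _) (h1 _ _)
    refine nic_ac_symm (nic_ac5 ?_ ?_ ?_ ?_ ?_)
    · exact nic_ac_symm (outer _ (n1 w v hw1 hv1).2)
    · exact nic_ac_symm (outer _ (n2 w v hw2 hv2).2)
    · exact nic_ac_symm (nic_ac5 (h3 _ _ (n1 v w hv1 hw1).2) (h3 _ _ (n2 v w hv2 hw2).2) (h2 _ _)
        (h3 _ _ (n1 v w hv1 hw1).1) (h3 _ _ (n2 v w hv2 hw2).1))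
    · exact nic_ac_symm (outer _ (n1 w v hw1 hv1).1)
    · exact nic_ac_symm (outer _ (n2 w v hw2 hv2).1)
  have hQ : nicolaiCharge2D p q a ^ 2 = 0 := by
    rw [pow_two]
    have h2 : (2 : ℂ) • (nicolaiCharge2D p q a * nicolaiCharge2D p q a) = 0 := by
      rw [two_smul]
      exact add_eq_zero_iff_eq_neg.2 key
    exact (smul_eq_zero.1 h2).resolve_left two_ne_zero
  refine ⟨hQ, ?_⟩
  rw [← star_eq_adjoint, ← star_pow, hQ, star_zero]
end
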